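/- arXiv:1108.4067 — 2 statements merged into one kernel-verified Lean document; each statement's English description precedes it below -/
import Mathlib

section
/- Let X and Z be real Hilbert spaces, Y a real inner product space, T, T_n : X → Y (n = 1, 2, …) bounded linear operators, L : D(L) ⊆ X → Z a closed linear operator with closed range, and assume there exists k > 0 with ‖Tx‖² + ‖Lx‖² ≥ k‖x‖² for all x ∈ D(L). Let q > 1, y, y_n ∈ Y, α > 0, α_n ≥ 0, and define on D(L) the functionals J(x) = ‖Tx − y‖² + α‖Lx‖^q and J_n(x) = ‖T_n x − y_n‖² + α_n‖Lx‖^q. Assume that α_n → α and y_n → y as n → ∞, and that T_n x → T x uniformly on L-bounded subsets of D(L). Let x̄ be the unique global minimizer of J and, for each n, let x_n be a global minimizer of J_n. Then x_n converges weakly to x̄. -/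
open Filter Topology

/-- The midpoint inequality for `t ↦ t ^ q`, `q > 1`, evaluated at norms. -/
lemma norm_midpoint_rpow_le {E : Type*} [SeminormedAddCommGroup E] [NormedSpace ℝ E]
    {q : ℝ} (hq : 1 < q) (a b : E) :
    ‖(1 / 2 : ℝ) • (a + b)‖ ^ q ≤ ((‖a‖ + ‖b‖) / 2) ^ q ∧
      ((‖a‖ + ‖b‖) / 2) ^ q ≤ (‖a‖ ^ q + ‖b‖ ^ q) / 2 := by
  constructor
  · refine Real.rpow_le_rpow (norm_nonneg _) ?_ (by linarith)
    rw [norm_smul, Real.norm_of_nonneg (by norm_num)]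
    linarith [norm_add_le a b]
  · have h := (convexOn_rpow hq.le).2 (norm_nonneg a) (norm_nonneg b)
      (by norm_num : (0 : ℝ) ≤ 1 / 2) (by norm_num : (0 : ℝ) ≤ 1 / 2) (by norm_num)
    simp only [smul_eq_mul] at h
    rw [show (‖a‖ + ‖b‖) / 2 = 1 / 2 * ‖a‖ + 1 / 2 * ‖b‖ by ring]
    linarith

/-- A bounded family of nonnegative reals whose midpoint convexity gap with `r` for `t ↦ t ^ q`
tends to zero converges to `r`. -/
lemma tendsto_of_tendsto_rpow_midpoint_gap {ι : Type*} {l : Filter ι} {q : ℝ} (hq : 1 < q)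
    {s : ι → ℝ} {r c : ℝ} (hr : 0 ≤ r) (hs : ∀ᶠ i in l, s i ∈ Set.Icc 0 c)
    (h : Tendsto (fun i => (s i ^ q + r ^ q) / 2 - ((s i + r) / 2) ^ q) l (𝓝 0)) :
    Tendsto s l (𝓝 r) := by
  refine isCompact_Icc.tendsto_nhds_of_unique_mapClusterPt hs fun t ht hcl => ?_
  have hpow : Continuous fun u : ℝ => u ^ q := Real.continuous_rpow_const (by linarith)
  have hgap : Continuous fun u : ℝ => (u ^ q + r ^ q) / 2 - ((u + r) / 2) ^ q :=
    ((hpow.add continuous_const).div_const 2).sub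
      (hpow.comp ((continuous_id.add continuous_const).div_const 2))
  have hzero : (t ^ q + r ^ q) / 2 - ((t + r) / 2) ^ q = 0 := by
    have hcl' := hcl.continuousAt_comp hgap.continuousAt
    exact eq_of_nhds_neBot (ClusterPt.mono hcl' h)
  by_contra hne
  have hstrict := (strictConvexOn_rpow hq).2 (Set.mem_Ici.2 ht.1) (Set.mem_Ici.2 hr) hne
    (by norm_num : (0 : ℝ) < 1 / 2) (by norm_num : (0 : ℝ) < 1 / 2) (by norm_num)
  simp only [smul_eq_mul] at hstrict
  rw [show 1 / 2 * t + 1 / 2 * r = (t + r) / 2 by ring] at hstrict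
  linarith

/-- The parallelogram law in midpoint form. -/
lemma norm_half_smul_add_sq {E : Type*} [SeminormedAddCommGroup E] [InnerProductSpace ℝ E]
    (a b : E) :
    ‖(1 / 2 : ℝ) • (a + b)‖ ^ 2 = (‖a‖ ^ 2 + ‖b‖ ^ 2) / 2 - ‖a - b‖ ^ 2 / 4 := by
  have h := parallelogram_law_with_norm ℝ a b
  rw [norm_smul, Real.norm_of_nonneg (by norm_num)]
  nlinarith

/-- Uniform convexity of `‖·‖ ^ q`, `q > 1`, on bounded subsets of an inner product space. -/
lemma tendsto_of_tendsto_norm_rpow_midpoint_gap {ι E : Type*} [NormedAddCommGroup E]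
    [InnerProductSpace ℝ E] {l : Filter ι} {q : ℝ} (hq : 1 < q) {a : ι → E} {b : E} {c : ℝ}
    (ha : ∀ᶠ i in l, ‖a i‖ ≤ c)
    (h : Tendsto (fun i => (‖a i‖ ^ q + ‖b‖ ^ q) / 2 - ‖(1 / 2 : ℝ) • (a i + b)‖ ^ q) l (𝓝 0)) :
    Tendsto a l (𝓝 b) := by
  have hnorm : Tendsto (fun i => ‖a i‖) l (𝓝 ‖b‖) := by
    refine tendsto_of_tendsto_rpow_midpoint_gap hq (norm_nonneg b)
      (ha.mono fun i hi => ⟨norm_nonneg _, hi⟩) (squeeze_zero (fun i => ?_) (fun i => ?_) h)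
    · linarith [(norm_midpoint_rpow_le hq (a i) b).2]
    · linarith [(norm_midpoint_rpow_le hq (a i) b).1]
  have hq0 : q ≠ 0 := by linarith
  have hmidpow : Tendsto (fun i => ‖(1 / 2 : ℝ) • (a i + b)‖ ^ q) l (𝓝 (‖b‖ ^ q)) := by
    have h1 := (((hnorm.rpow_const (Or.inr (by linarith : 0 ≤ q))).add_const
      (‖b‖ ^ q)).div_const 2).sub h
    simpa using h1
  have hmid : Tendsto (fun i => ‖(1 / 2 : ℝ) • (a i + b)‖) l (𝓝 ‖b‖) := by
    have h1 := hmidpow.rpow_const (p := q⁻¹) (Or.inr (inv_nonneg.2 (by linarith)))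
    simpa only [Real.rpow_rpow_inv (norm_nonneg _) hq0] using h1
  rw [tendsto_iff_norm_sub_tendsto_zero]
  have hsq : Tendsto (fun i => ‖a i - b‖ ^ 2) l (𝓝 0) := by
    have h1 := ((((hnorm.pow 2).add_const (‖b‖ ^ 2)).div_const 2).sub (hmid.pow 2)).const_mul 4
    have h2 : (4 : ℝ) * ((‖b‖ ^ 2 + ‖b‖ ^ 2) / 2 - ‖b‖ ^ 2) = 0 := by ring
    rw [h2] at h1
    refine h1.congr fun i => ?_
    rw [norm_half_smul_add_sq]
    ring
  simpa using hsq.sqrt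

/-- If `u` is eventually bounded and `u - v` tends to zero, so does `‖v‖ ^ 2 - ‖u‖ ^ 2`. -/
lemma tendsto_norm_sq_sub_norm_sq {ι E : Type*} [SeminormedAddCommGroup E] {l : Filter ι}
    {u v : ι → E} {M : ℝ} (hu : ∀ᶠ i in l, ‖u i‖ ≤ M)
    (h : Tendsto (fun i => u i - v i) l (𝓝 0)) :
    Tendsto (fun i => ‖v i‖ ^ 2 - ‖u i‖ ^ 2) l (𝓝 0) := by
  have hd : Tendsto (fun i => ‖u i - v i‖) l (𝓝 0) := by simpa using h.norm
  have hb : Tendsto (fun i => ‖u i - v i‖ * (‖u i - v i‖ + 2 * M)) l (𝓝 0) := by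
    simpa using hd.mul (hd.add_const (2 * M))
  refine squeeze_zero_norm' (hu.mono fun i hi => ?_) hb
  have h1 : |‖v i‖ - ‖u i‖| ≤ ‖u i - v i‖ := by
    rw [norm_sub_rev]
    exact abs_norm_sub_norm_le _ _
  rw [Real.norm_eq_abs, show ‖v i‖ ^ 2 - ‖u i‖ ^ 2 = (‖v i‖ - ‖u i‖) * (‖v i‖ + ‖u i‖) by ring,
    abs_mul, abs_of_nonneg (by positivity : 0 ≤ ‖v i‖ + ‖u i‖)]
  refine mul_le_mul h1 ?_ (by positivity) (norm_nonneg _)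
  linarith [le_abs_self (‖v i‖ - ‖u i‖)]

/-- Weak stability for the closed-operator penalizer (Lemma 4.1): minimizers of the
perturbed functionals `Jₙ(x) = ‖Tₙx - yₙ‖² + αₙ ‖Lx‖^q` converge weakly to the unique
minimizer of `J(x) = ‖Tx - y‖² + α ‖Lx‖^q`. -/
theorem weak_stability_closed_operator_penalizer
    {X Z Y : Type*}
    [NormedAddCommGroup X] [InnerProductSpace ℝ X] [CompleteSpace X]
    [NormedAddCommGroup Z] [InnerProductSpace ℝ Z] [CompleteSpace Z]
    [NormedAddCommGroup Y] [InnerProductSpace ℝ Y]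
    (T : X →L[ℝ] Y) (Tn : ℕ → X →L[ℝ] Y) (L : X →ₗ.[ℝ] Z)
    (hLclosed : L.IsClosed)
    (hLrange : IsClosed (LinearMap.range L.toFun : Set Z))
    (k : ℝ) (hk : 0 < k)
    (hcompl : ∀ x : L.domain, k * ‖(x : X)‖ ^ 2 ≤ ‖T (x : X)‖ ^ 2 + ‖L x‖ ^ 2)
    (q : ℝ) (hq : 1 < q)
    (y : Y) (yn : ℕ → Y) (α : ℝ) (hα : 0 < α) (αn : ℕ → ℝ) (hαn : ∀ n, 0 ≤ αn n)
    (hαconv : Tendsto αn atTop (𝓝 α)) (hyconv : Tendsto yn atTop (𝓝 y))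
    -- Tₙ x → T x uniformly on L-bounded subsets of D(L)
    (hTconsist : ∀ c : ℝ, 0 < c → ∀ ε : ℝ, 0 < ε → ∃ N : ℕ, ∀ n ≥ N, ∀ x : L.domain,
      ‖L x‖ ≤ c → ‖Tn n (x : X) - T (x : X)‖ < ε)
    -- x̄ is the unique global minimizer of J on D(L)
    (xbar : L.domain)
    (hxbarmin : ∀ x : L.domain,
      ‖T (xbar : X) - y‖ ^ 2 + α * ‖L xbar‖ ^ q ≤ ‖T (x : X) - y‖ ^ 2 + α * ‖L x‖ ^ q)
    (hxbaruniq : ∀ x' : L.domain,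
      (∀ x : L.domain,
        ‖T (x' : X) - y‖ ^ 2 + α * ‖L x'‖ ^ q ≤ ‖T (x : X) - y‖ ^ 2 + α * ‖L x‖ ^ q) →
      x' = xbar)
    -- each xₙ is a global minimizer of Jₙ on D(L)
    (xn : ℕ → L.domain)
    (hxnmin : ∀ n, ∀ x : L.domain,
      ‖Tn n (xn n : X) - yn n‖ ^ 2 + αn n * ‖L (xn n)‖ ^ q ≤
        ‖Tn n (x : X) - yn n‖ ^ 2 + αn n * ‖L x‖ ^ q) :
    ∀ f : X →L[ℝ] ℝ, Tendsto (fun n => f (xn n : X)) atTop (𝓝 (f (xbar : X))) := by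
  have hq0 : 0 < q := by linarith
  obtain ⟨J, hJ⟩ : ∃ J : L.domain → ℝ,
      ∀ x, J x = ‖T (x : X) - y‖ ^ 2 + α * ‖L x‖ ^ q := ⟨_, fun _ => rfl⟩
  simp only [← hJ] at hxbarmin
  have hTlim : ∀ (z : ℕ → L.domain) (c : ℝ), (∀ᶠ n in atTop, ‖L (z n)‖ ≤ c) →
      Tendsto (fun n => Tn n (z n : X) - T (z n : X)) atTop (𝓝 0) := by
    intro z c hz
    refine Metric.tendsto_nhds.2 fun ε hε => ?_
    obtain ⟨N, hN⟩ := hTconsist (max c 1) (by positivity) ε hε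
    filter_upwards [hz, eventually_ge_atTop N] with n hn hnN
    simpa using hN n hnN (z n) (hn.trans (le_max_left _ _))
  have hJnbar : Tendsto (fun n => ‖Tn n (xbar : X) - yn n‖ ^ 2 + αn n * ‖L xbar‖ ^ q) atTop
      (𝓝 (J xbar)) := by
    have h1 : Tendsto (fun n => Tn n (xbar : X)) atTop (𝓝 (T (xbar : X))) :=
      tendsto_sub_nhds_zero_iff.1
        (hTlim (fun _ => xbar) ‖L xbar‖ (Eventually.of_forall fun _ => le_rfl))
    rw [hJ]
    exact ((h1.sub hyconv).norm.pow 2).add (hαconv.mul_const _)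
  set B := J xbar + 1 with hB
  have hJn : ∀ᶠ n in atTop, ‖Tn n (xn n : X) - yn n‖ ^ 2 + αn n * ‖L (xn n)‖ ^ q ≤ B := by
    filter_upwards [hJnbar.eventually_le_const (lt_add_one (J xbar))] with n hn
    exact (hxnmin n xbar).trans hn
  have hLpow : ∀ᶠ n in atTop, ‖L (xn n)‖ ^ q ≤ B / (α / 2) := by
    filter_upwards [hJn, hαconv.eventually_const_le (half_lt_self hα)] with n hn hαn'
    rw [le_div_iff₀ (half_pos hα)]
    have hp : 0 ≤ ‖L (xn n)‖ ^ q := by positivity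
    nlinarith [mul_le_mul_of_nonneg_right hαn' hp, sq_nonneg ‖Tn n (xn n : X) - yn n‖]
  have hLbdd : ∀ᶠ n in atTop, ‖L (xn n)‖ ≤ (B / (α / 2)) ^ q⁻¹ := by
    filter_upwards [hLpow] with n hn
    rw [← Real.rpow_rpow_inv (norm_nonneg (L (xn n))) hq0.ne']
    exact Real.rpow_le_rpow (by positivity) hn (by positivity)
  have hres : ∀ᶠ n in atTop, ‖Tn n (xn n : X) - yn n‖ ≤ √B := by
    filter_upwards [hJn] with n hn
    have hp : 0 ≤ αn n * ‖L (xn n)‖ ^ q := mul_nonneg (hαn n) (by positivity)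
    exact Real.le_sqrt_of_sq_le (by linarith)
  have hdiff : Tendsto (fun n => (Tn n (xn n : X) - yn n) - (T (xn n : X) - y)) atTop (𝓝 0) := by
    have h1 := (hTlim xn _ hLbdd).sub (tendsto_sub_nhds_zero_iff.2 hyconv)
    rw [sub_zero] at h1
    refine h1.congr fun n => ?_
    abel
  have hpen : Tendsto (fun n => (α - αn n) * ‖L (xn n)‖ ^ q) atTop (𝓝 0) := by
    have h1 : Tendsto (fun n => |α - αn n| * (B / (α / 2))) atTop (𝓝 0) := by
      simpa using (hαconv.const_sub α).abs.mul_const (B / (α / 2))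
    refine squeeze_zero_norm' (hLpow.mono fun n hn => ?_) h1
    rw [norm_mul, Real.norm_eq_abs, Real.norm_of_nonneg (by positivity)]
    gcongr
  have hJlim : Tendsto (fun n => J (xn n)) atTop (𝓝 (J xbar)) := by
    have h1 := (hJnbar.add (tendsto_norm_sq_sub_norm_sq hres hdiff)).add hpen
    rw [add_zero, add_zero] at h1
    refine tendsto_of_tendsto_of_tendsto_of_le_of_le tendsto_const_nhds h1
      (fun n => hxbarmin (xn n)) fun n => ?_
    have h2 := hxnmin n xbar
    simp only [hJ]
    linarith
  have hgap : Tendsto (fun n => (J (xn n) - J xbar) / 2) atTop (𝓝 0) := by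
    simpa using (hJlim.sub_const (J xbar)).div_const 2
  have hmid : ∀ n, ‖T (xn n : X) - T (xbar : X)‖ ^ 2 / 4 +
      α * ((‖L (xn n)‖ ^ q + ‖L xbar‖ ^ q) / 2 - ‖(1 / 2 : ℝ) • (L (xn n) + L xbar)‖ ^ q) ≤
        (J (xn n) - J xbar) / 2 := by
    intro n
    have h1 := hxbarmin ((1 / 2 : ℝ) • (xn n + xbar))
    have h2 : T (((1 / 2 : ℝ) • (xn n + xbar) : L.domain) : X) - y =
        (1 / 2 : ℝ) • ((T (xn n : X) - y) + (T (xbar : X) - y)) := by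
      simp only [Submodule.coe_smul, Submodule.coe_add, map_smul, map_add]
      module
    have h3 := norm_half_smul_add_sq (T (xn n : X) - y) (T (xbar : X) - y)
    rw [sub_sub_sub_cancel_right] at h3
    rw [hJ ((1 / 2 : ℝ) • (xn n + xbar)), h2, h3, L.map_smul, L.map_add] at h1
    have h4 := hJ (xn n)
    have h5 := hJ xbar
    linarith
  have hpengap : ∀ n, 0 ≤
      (‖L (xn n)‖ ^ q + ‖L xbar‖ ^ q) / 2 - ‖(1 / 2 : ℝ) • (L (xn n) + L xbar)‖ ^ q := fun n => by
    obtain ⟨h1, h2⟩ := norm_midpoint_rpow_le hq (L (xn n)) (L xbar)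
    linarith
  have hTsq : Tendsto (fun n => ‖T (xn n : X) - T (xbar : X)‖ ^ 2) atTop (𝓝 0) := by
    refine squeeze_zero (fun n => by positivity) (fun n => ?_)
      (by simpa using hgap.const_mul 4 :
        Tendsto (fun n => 4 * ((J (xn n) - J xbar) / 2)) atTop (𝓝 0))
    linarith [hmid n, mul_nonneg hα.le (hpengap n)]
  have hLlim : Tendsto (fun n => L (xn n)) atTop (𝓝 (L xbar)) := by
    refine tendsto_of_tendsto_norm_rpow_midpoint_gap hq hLbdd
      (squeeze_zero hpengap (fun n => ?_)
        (by simpa using hgap.div_const α :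
          Tendsto (fun n => (J (xn n) - J xbar) / 2 / α) atTop (𝓝 0)))
    rw [le_div_iff₀ hα]
    linarith [hmid n, sq_nonneg ‖T (xn n : X) - T (xbar : X)‖]
  have hLsq : Tendsto (fun n => ‖L (xn n) - L xbar‖ ^ 2) atTop (𝓝 0) := by
    simpa using (tendsto_iff_norm_sub_tendsto_zero.1 hLlim).pow 2
  have hxsq : Tendsto (fun n => ‖(xn n : X) - xbar‖ ^ 2) atTop (𝓝 0) := by
    refine squeeze_zero (fun n => by positivity) (fun n => ?_)
      (by simpa using (hTsq.add hLsq).div_const k : Tendsto (fun n =>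
        (‖T (xn n : X) - T (xbar : X)‖ ^ 2 + ‖L (xn n) - L xbar‖ ^ 2) / k) atTop (𝓝 0))
    rw [le_div_iff₀ hk, mul_comm]
    simpa only [Submodule.coe_sub, map_sub, L.map_sub] using hcompl (xn n - xbar)
  have hx : Tendsto (fun n => (xn n : X)) atTop (𝓝 (xbar : X)) := by
    rw [tendsto_iff_norm_sub_tendsto_zero]
    simpa using hxsq.sqrt
  exact fun f => (f.continuous.tendsto _).comp hx
end

section
/- Let N ≥ 1 be an integer, let X and Z_1, …, Z_N be real Hilbert spaces, Y a real inner product space, T : X → Y a bounded linear operator, D a linear subspace of X, and for each i = 1, …, N let L_i : D → Z_i be a closed linear operator whose range R(L_i) is a closed subspace of Z_i. Assume T, L_1, …, L_N are complemented, i.e. there exists k > 0 such that ‖Tx‖² + Σ_{i=1}^N ‖L_i x‖² ≥ k‖x‖² for all x ∈ D. Then for every y ∈ Y, every α_1, …, α_N > 0 and every q_1, …, q_N with q_i > 1 for all i, the functional J(x) = ‖Tx − y‖² + Σ_{i=1}^N α_i ‖L_i x‖^{q_i} has a unique global minimizer on D. -/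
open Filter Topology

/-- The power `t ↦ t ^ q` with `q > 1` is midpoint convex with a uniform gap on bounded sets of
data `a = ‖u‖`, `b = ‖v‖`, `c = ‖(u + v) / 2‖` with `ε ≤ ‖u - v‖`. -/
lemma exists_rpow_midpoint_gap {q : ℝ} (hq : 1 < q) {ε : ℝ} (hε : 0 < ε) (R : ℝ) :
    ∃ δ > 0, ∀ a b c : ℝ, 0 ≤ a → 0 ≤ b → 0 ≤ c → a ≤ R → b ≤ R → c ≤ (a + b) / 2 →
      c ^ 2 ≤ (a ^ 2 + b ^ 2) / 2 - ε ^ 2 / 4 → c ^ q + δ ≤ (a ^ q + b ^ q) / 2 := by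
  have hq0 : 0 < q := by linarith
  let B : Set (ℝ × ℝ × ℝ) := Set.Icc 0 R ×ˢ Set.Icc 0 R ×ˢ Set.Icc 0 R
  let K : Set (ℝ × ℝ × ℝ) := B ∩
    ({p | p.2.2 ≤ (p.1 + p.2.1) / 2} ∩
      {p | p.2.2 ^ 2 ≤ (p.1 ^ 2 + p.2.1 ^ 2) / 2 - ε ^ 2 / 4})
  let g : ℝ × ℝ × ℝ → ℝ := fun p => (p.1 ^ q + p.2.1 ^ q) / 2 - p.2.2 ^ q
  have hK : IsCompact K := by
    refine (isCompact_Icc.prod (isCompact_Icc.prod isCompact_Icc)).inter_right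
      (IsClosed.inter ?_ ?_)
    · exact isClosed_le (by fun_prop) (by fun_prop)
    · exact isClosed_le (by fun_prop) (by fun_prop)
  have hg : Continuous g := by
    have h := Real.continuous_rpow_const hq0.le
    exact (((h.comp continuous_fst).add
      (h.comp (continuous_fst.comp continuous_snd))).div_const 2).sub
      (h.comp (continuous_snd.comp continuous_snd))
  have hpos : ∀ p ∈ K, 0 < g p := by
    rintro ⟨a, b, c⟩ ⟨⟨ha, hb, hc⟩, h1, h2⟩
    simp only [Set.mem_Icc, Set.mem_ofPred_eq] at ha hb hc h1 h2
    change 0 < (a ^ q + b ^ q) / 2 - c ^ q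
    rcases eq_or_ne a b with rfl | hab
    · have hca : c < a := by
        have : c ^ 2 < a ^ 2 := by nlinarith [sq_pos_of_pos hε]
        exact lt_of_pow_lt_pow_left₀ 2 ha.1 this
      have := Real.rpow_lt_rpow hc.1 hca hq0
      linarith
    · have hs := (strictConvexOn_rpow hq).2 (Set.mem_Ici.2 ha.1) (Set.mem_Ici.2 hb.1) hab
        (show (0 : ℝ) < 1 / 2 by norm_num) (show (0 : ℝ) < 1 / 2 by norm_num) (by norm_num)
      simp only [smul_eq_mul] at hs
      have hle : c ^ q ≤ (1 / 2 * a + 1 / 2 * b) ^ q :=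
        Real.rpow_le_rpow hc.1 (by linarith) hq0.le
      linarith
  have hmem : ∀ a b c : ℝ, 0 ≤ a → 0 ≤ b → 0 ≤ c → a ≤ R → b ≤ R → c ≤ (a + b) / 2 →
      c ^ 2 ≤ (a ^ 2 + b ^ 2) / 2 - ε ^ 2 / 4 → (a, b, c) ∈ K :=
    fun a b c ha hb hc haR hbR h1 h2 =>
      ⟨⟨⟨ha, haR⟩, ⟨hb, hbR⟩, ⟨hc, by dsimp only; linarith⟩⟩, h1, h2⟩
  rcases K.eq_empty_or_nonempty with hE | hne
  · refine ⟨1, one_pos, fun a b c ha hb hc haR hbR h1 h2 => ?_⟩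
    simpa [hE] using hmem a b c ha hb hc haR hbR h1 h2
  · obtain ⟨p, hp, hmin⟩ := hK.exists_isMinOn hne hg.continuousOn
    refine ⟨g p, hpos p hp, fun a b c ha hb hc haR hbR h1 h2 => ?_⟩
    have h : g p ≤ (a ^ q + b ^ q) / 2 - c ^ q := hmin (hmem a b c ha hb hc haR hbR h1 h2)
    linarith

section InnerProductSpace

variable {E : Type*} [NormedAddCommGroup E] [InnerProductSpace ℝ E]

lemma norm_midpoint_le (u v : E) : ‖(1 / 2 : ℝ) • (u + v)‖ ≤ (‖u‖ + ‖v‖) / 2 := by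
  rw [norm_smul, Real.norm_of_nonneg (by norm_num : (0 : ℝ) ≤ 1 / 2)]
  linarith [norm_add_le u v]

lemma norm_sq_midpoint (u v : E) :
    ‖(1 / 2 : ℝ) • (u + v)‖ ^ 2 = (‖u‖ ^ 2 + ‖v‖ ^ 2) / 2 - ‖u - v‖ ^ 2 / 4 := by
  rw [norm_smul, Real.norm_of_nonneg (by norm_num : (0 : ℝ) ≤ 1 / 2)]
  linarith [parallelogram_law_with_norm ℝ u v]

lemma norm_rpow_midpoint_le {q : ℝ} (hq : 1 ≤ q) (u v : E) :
    ‖(1 / 2 : ℝ) • (u + v)‖ ^ q ≤ (‖u‖ ^ q + ‖v‖ ^ q) / 2 := by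
  have hs := (convexOn_rpow hq).2 (Set.mem_Ici.2 (norm_nonneg u)) (Set.mem_Ici.2 (norm_nonneg v))
    (show (0 : ℝ) ≤ 1 / 2 by norm_num) (show (0 : ℝ) ≤ 1 / 2 by norm_num) (by norm_num)
  simp only [smul_eq_mul] at hs
  have hle : ‖(1 / 2 : ℝ) • (u + v)‖ ^ q ≤ (1 / 2 * ‖u‖ + 1 / 2 * ‖v‖) ^ q :=
    Real.rpow_le_rpow (norm_nonneg _) (by linarith [norm_midpoint_le u v]) (by linarith)
  linarith

/-- Two bounded families whose midpoint convexity gap for `‖·‖ ^ q`, `q > 1`, tends to zero are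
asymptotically equal. -/
lemma tendsto_norm_sub_of_rpow_gap {ι : Type*} {l : Filter ι} {q : ℝ} (hq : 1 < q) {R : ℝ}
    {a b : ι → E} (ha : ∀ᶠ n in l, ‖a n‖ ≤ R) (hb : ∀ᶠ n in l, ‖b n‖ ≤ R)
    (hgap : Tendsto (fun n => (‖a n‖ ^ q + ‖b n‖ ^ q) / 2 - ‖(1 / 2 : ℝ) • (a n + b n)‖ ^ q)
      l (𝓝 0)) :
    Tendsto (fun n => ‖a n - b n‖) l (𝓝 0) := by
  rw [Metric.tendsto_nhds]
  intro ε hε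
  obtain ⟨δ, hδ, h⟩ := exists_rpow_midpoint_gap hq hε R
  filter_upwards [ha, hb, hgap.eventually_lt_const hδ] with n han hbn hn
  rw [dist_zero_right, norm_norm]
  by_contra! hcon
  have := h ‖a n‖ ‖b n‖ ‖(1 / 2 : ℝ) • (a n + b n)‖ (norm_nonneg _) (norm_nonneg _)
    (norm_nonneg _) han hbn (norm_midpoint_le _ _) (by
      rw [norm_sq_midpoint]
      have : ε ^ 2 ≤ ‖a n - b n‖ ^ 2 := by gcongr
      linarith)
  linarith

end InnerProductSpace

section Penalized

variable {ι X Y : Type*} [Fintype ι] {Z : ι → Type*} [NormedAddCommGroup X] [InnerProductSpace ℝ X]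
  [∀ i, NormedAddCommGroup (Z i)] [∀ i, InnerProductSpace ℝ (Z i)]
  [NormedAddCommGroup Y] [InnerProductSpace ℝ Y]

/-- The functional `x ↦ ‖T x - y‖² + ∑ i, α i * ‖L i x‖ ^ q i` on `D`. -/
noncomputable def penalizedFunctional (T : X →L[ℝ] Y) {D : Submodule ℝ X} (L : ∀ i, D →ₗ[ℝ] Z i)
    (y : Y) (α q : ι → ℝ) (x : D) : ℝ :=
  ‖T (x : X) - y‖ ^ 2 + ∑ i, α i * ‖L i x‖ ^ q i

variable {T : X →L[ℝ] Y} {D : Submodule ℝ X} {L : ∀ i, D →ₗ[ℝ] Z i} {y : Y} {α q : ι → ℝ}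

lemma penalizedFunctional_nonneg (hα : ∀ i, 0 < α i) (x : D) :
    0 ≤ penalizedFunctional T L y α q x :=
  add_nonneg (sq_nonneg _) (Finset.sum_nonneg fun i _ =>
    mul_nonneg (hα i).le (Real.rpow_nonneg (norm_nonneg _) _))

lemma norm_le_of_penalizedFunctional_le (hα : ∀ i, 0 < α i) (hq : ∀ i, 1 < q i) {x : D} {M : ℝ}
    (h : penalizedFunctional T L y α q x ≤ M) (i : ι) : ‖L i x‖ ≤ (M / α i) ^ (q i)⁻¹ := by
  have hqi : 0 < q i := by linarith [hq i]
  have h1 : α i * ‖L i x‖ ^ q i ≤ ∑ j, α j * ‖L j x‖ ^ q j :=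
    Finset.single_le_sum (f := fun j => α j * ‖L j x‖ ^ q j)
      (fun j _ => mul_nonneg (hα j).le (Real.rpow_nonneg (norm_nonneg _) _)) (Finset.mem_univ i)
  have h2 : ‖L i x‖ ^ q i ≤ M / α i := by
    rw [le_div_iff₀' (hα i)]
    unfold penalizedFunctional at h
    linarith [sq_nonneg ‖T (x : X) - y‖]
  have h0 := Real.rpow_nonneg (norm_nonneg (L i x)) (q i)
  calc ‖L i x‖ = (‖L i x‖ ^ q i) ^ (q i)⁻¹ := (Real.rpow_rpow_inv (norm_nonneg _) hqi.ne').symm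
    _ ≤ _ := Real.rpow_le_rpow h0 h2 (inv_nonneg.2 hqi.le)

lemma penalizedFunctional_gap (a b : D) :
    (penalizedFunctional T L y α q a + penalizedFunctional T L y α q b) / 2 -
        penalizedFunctional T L y α q ((1 / 2 : ℝ) • (a + b)) =
      ‖T (a : X) - T (b : X)‖ ^ 2 / 4 +
        ∑ i, α i * ((‖L i a‖ ^ q i + ‖L i b‖ ^ q i) / 2 -
          ‖(1 / 2 : ℝ) • (L i a + L i b)‖ ^ q i) := by
  have hT : T (((1 / 2 : ℝ) • (a + b) : D) : X) - y =
      (1 / 2 : ℝ) • ((T (a : X) - y) + (T (b : X) - y)) := by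
    push_cast
    rw [map_smul, map_add]
    module
  have hsum : ∑ i, α i * ((‖L i a‖ ^ q i + ‖L i b‖ ^ q i) / 2 -
        ‖(1 / 2 : ℝ) • (L i a + L i b)‖ ^ q i) =
      (∑ i, α i * ‖L i a‖ ^ q i + ∑ i, α i * ‖L i b‖ ^ q i) / 2 -
        ∑ i, α i * ‖(1 / 2 : ℝ) • (L i a + L i b)‖ ^ q i := by
    rw [← Finset.sum_add_distrib, Finset.sum_div, ← Finset.sum_sub_distrib]
    exact Finset.sum_congr rfl fun i _ => by ring
  unfold penalizedFunctional
  rw [hT, norm_sq_midpoint, sub_sub_sub_cancel_right, hsum]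
  simp only [map_smul, map_add]
  ring

/-- Two minimizing families for the penalized functional have asymptotically equal images under
`L i`, and are themselves asymptotically equal when `T` and the `L i` are complemented. -/
lemma tendsto_norm_sub_of_minimizing (hα : ∀ i, 0 < α i) (hq : ∀ i, 1 < q i) {k : ℝ} (hk : 0 < k)
    (hcompl : ∀ x : D, k * ‖(x : X)‖ ^ 2 ≤ ‖T (x : X)‖ ^ 2 + ∑ i, ‖L i x‖ ^ 2)
    {m : ℝ} (hm : ∀ x, m ≤ penalizedFunctional T L y α q x) {κ : Type*} {l : Filter κ}
    {a b : κ → D} (ha : Tendsto (fun n => penalizedFunctional T L y α q (a n)) l (𝓝 m))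
    (hb : Tendsto (fun n => penalizedFunctional T L y α q (b n)) l (𝓝 m)) :
    Tendsto (fun n => ‖(a n : X) - (b n : X)‖) l (𝓝 0) ∧
      ∀ i, Tendsto (fun n => ‖L i (a n) - L i (b n)‖) l (𝓝 0) := by
  let J := penalizedFunctional T L y α q
  have hbound : Tendsto (fun n => (J (a n) + J (b n)) / 2 - m) l (𝓝 0) := by
    simpa using ((ha.add hb).div_const 2).sub_const m
  let gap : κ → ι → ℝ := fun n i => (‖L i (a n)‖ ^ q i + ‖L i (b n)‖ ^ q i) / 2 -
    ‖(1 / 2 : ℝ) • (L i (a n) + L i (b n))‖ ^ q i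
  have hgap0 : ∀ n i, 0 ≤ gap n i := fun n i =>
    sub_nonneg.2 (norm_rpow_midpoint_le (hq i).le _ _)
  have hle : ∀ n, ‖T (a n : X) - T (b n : X)‖ ^ 2 / 4 + ∑ i, α i * gap n i ≤
      (J (a n) + J (b n)) / 2 - m := fun n => by
    rw [← penalizedFunctional_gap (y := y)]
    exact sub_le_sub_left (hm _) _
  have hT : Tendsto (fun n => ‖T (a n : X) - T (b n : X)‖ ^ 2) l (𝓝 0) := by
    refine squeeze_zero (fun n => sq_nonneg _) (fun n => ?_) (by simpa using hbound.const_mul 4)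
    have : 0 ≤ ∑ i, α i * gap n i :=
      Finset.sum_nonneg fun i _ => mul_nonneg (hα i).le (hgap0 n i)
    linarith [hle n]
  have hL : ∀ i, Tendsto (fun n => ‖L i (a n) - L i (b n)‖) l (𝓝 0) := fun i => by
    refine tendsto_norm_sub_of_rpow_gap (hq i) (R := ((m + 1) / α i) ^ (q i)⁻¹) ?_ ?_ ?_
    · filter_upwards [ha.eventually_lt_const (lt_add_one m)] with n hn
      exact norm_le_of_penalizedFunctional_le hα hq hn.le i
    · filter_upwards [hb.eventually_lt_const (lt_add_one m)] with n hn
      exact norm_le_of_penalizedFunctional_le hα hq hn.le i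
    · refine squeeze_zero (fun n => hgap0 n i) (fun n => ?_)
        (by simpa using hbound.const_mul (α i)⁻¹)
      have h1 : α i * gap n i ≤ ∑ j, α j * gap n j :=
        Finset.single_le_sum (f := fun j => α j * gap n j)
          (fun j _ => mul_nonneg (hα j).le (hgap0 n j)) (Finset.mem_univ i)
      rw [le_inv_mul_iff₀ (hα i)]
      change α i * gap n i ≤ _
      linarith [hle n, sq_nonneg ‖T (a n : X) - T (b n : X)‖]
  refine ⟨?_, hL⟩
  have hsq : Tendsto (fun n => ‖(a n : X) - (b n : X)‖ ^ 2) l (𝓝 0) := by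
    have hsum : Tendsto (fun n => k⁻¹ * (‖T (a n : X) - T (b n : X)‖ ^ 2 +
        ∑ i, ‖L i (a n) - L i (b n)‖ ^ 2)) l (𝓝 0) := by
      simpa using (hT.add (tendsto_finsetSum Finset.univ fun i _ => (hL i).pow 2)).const_mul k⁻¹
    refine squeeze_zero (fun n => sq_nonneg _) (fun n => ?_) hsum
    rw [le_inv_mul_iff₀ hk]
    simpa using hcompl (a n - b n)
  simpa using hsq.sqrt

end Penalized

/-- Existence and uniqueness of the global minimizer of
`J(x) = ‖Tx - y‖² + Σᵢ αᵢ ‖Lᵢx‖^{qᵢ}` on a common domain `D` of closed, closed-range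
linear operators `Lᵢ`, when `T, L₁, …, L_N` are complemented (Theorem 4.2). -/
theorem existence_uniqueness_sum_closed_operator_penalizers
    {N : ℕ} (hN : 1 ≤ N)
    {X Y : Type*} {Z : Fin N → Type*}
    [NormedAddCommGroup X] [InnerProductSpace ℝ X] [CompleteSpace X]
    [∀ i, NormedAddCommGroup (Z i)] [∀ i, InnerProductSpace ℝ (Z i)]
    [∀ i, CompleteSpace (Z i)]
    [NormedAddCommGroup Y] [InnerProductSpace ℝ Y]
    (T : X →L[ℝ] Y) (D : Submodule ℝ X)
    (L : ∀ i : Fin N, D →ₗ[ℝ] Z i)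
    -- each Lᵢ is a closed operator (its graph is closed in X × Zᵢ)
    (hLclosed : ∀ i, IsClosed {p : X × Z i | ∃ x : D, p.1 = (x : X) ∧ p.2 = L i x})
    -- each Lᵢ has (weakly) closed range
    (hLrange : ∀ i, IsClosed ((LinearMap.range (L i) : Submodule ℝ (Z i)) : Set (Z i)))
    -- T, L₁, …, L_N are complemented
    (k : ℝ) (hk : 0 < k)
    (hcompl : ∀ x : D, k * ‖(x : X)‖ ^ 2 ≤ ‖T (x : X)‖ ^ 2 + ∑ i, ‖L i x‖ ^ 2)
    (y : Y) (α q : Fin N → ℝ) (hα : ∀ i, 0 < α i) (hq : ∀ i, 1 < q i) :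
    ∃! xbar : D, ∀ x : D,
      ‖T (xbar : X) - y‖ ^ 2 + ∑ i, α i * ‖L i xbar‖ ^ (q i) ≤
        ‖T (x : X) - y‖ ^ 2 + ∑ i, α i * ‖L i x‖ ^ (q i) := by
  let J : D → ℝ := penalizedFunctional T L y α q
  have hbdd : BddBelow (Set.range J) :=
    ⟨0, by rintro _ ⟨x, rfl⟩; exact penalizedFunctional_nonneg hα x⟩
  have hm : ∀ x, (⨅ x, J x) ≤ J x := ciInf_le hbdd
  change ∃! xbar : D, ∀ x : D, J xbar ≤ J x
  obtain ⟨v, -, hv, hvmem⟩ := exists_seq_tendsto_sInf (Set.range_nonempty J) hbdd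
  choose u hu using hvmem
  have huJ : Tendsto (fun n => J (u n)) atTop (𝓝 (⨅ x, J x)) := by
    simp only [hu]
    exact hv
  obtain ⟨hX, hL⟩ := tendsto_norm_sub_of_minimizing hα hq hk hcompl hm
    (huJ.comp tendsto_fst) (huJ.comp tendsto_snd)
  have hXc : CauchySeq fun n => (u n : X) := by
    rw [cauchySeq_iff_tendsto_dist_atTop_0, ← prod_atTop_atTop_eq]
    simpa only [dist_eq_norm] using hX
  have hLc : ∀ i, CauchySeq fun n => L i (u n) := fun i => by
    rw [cauchySeq_iff_tendsto_dist_atTop_0, ← prod_atTop_atTop_eq]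
    simpa only [dist_eq_norm] using hL i
  obtain ⟨x, hx⟩ := cauchySeq_tendsto_of_complete hXc
  choose z hz using fun i => cauchySeq_tendsto_of_complete (hLc i)
  have hgraph : ∀ i, ∃ w : D, x = (w : X) ∧ z i = L i w := fun i =>
    (hLclosed i).mem_of_tendsto (hx.prodMk_nhds (hz i)) (Eventually.of_forall fun n =>
      ⟨u n, rfl, rfl⟩)
  obtain ⟨w, hw, -⟩ := hgraph ⟨0, hN⟩
  have hzw : ∀ i, z i = L i w := fun i => by
    obtain ⟨w', hw', hz'⟩ := hgraph i
    rwa [show w = w' from Subtype.ext (hw.symm.trans hw')]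
  have hlim : Tendsto (fun n => J (u n)) atTop (𝓝 (J w)) := by
    refine Tendsto.add ?_ (tendsto_finsetSum Finset.univ fun i _ => ?_)
    · rw [← hw]
      exact (((T.continuous.tendsto x).comp hx).sub_const y).norm.pow 2
    · rw [← hzw i]
      exact ((hz i).norm.rpow_const (Or.inr (by linarith [hq i]))).const_mul (α i)
  have hJw : J w = ⨅ x, J x := tendsto_nhds_unique hlim huJ
  refine ⟨w, fun x => hJw.trans_le (hm x), fun w' hw' => ?_⟩
  have hJw' : J w' = ⨅ x, J x := le_antisymm ((hw' w).trans_eq hJw) (hm w')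
  have h := (tendsto_norm_sub_of_minimizing hα hq hk hcompl hm (l := (atTop : Filter ℕ))
    (a := fun _ => w') (b := fun _ => w) (tendsto_const_nhds_iff.2 hJw')
    (tendsto_const_nhds_iff.2 hJw)).1
  exact Subtype.ext (sub_eq_zero.1 (norm_eq_zero.1 (tendsto_const_nhds_iff.1 h)))
end
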